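/- arXiv:2010.08035 — 3 statements merged into one kernel-verified Lean document; each statement's English description precedes it below -/
import Mathlib

section
/- Fix an S-structure (𝕊, ℙ). Let v₁, v₂ be pseudovertices with v₁ ≤ v₂, and let ŝ ∈ Ŝ be a partial bijection locally determined by S whose domain contains im(v₁) = im(v₂). Then: (1) the action of ŝ is well-defined on equivalence classes and on pseudovertices, i.e., if v₁ = ṽ₁ as pseudovertices then ŝ·v₁ = ŝ·ṽ₁; (2) the action is order-preserving: ŝ·v₁ ≤ ŝ·v₂; and (3) im(ŝ·v₁) = ŝ(im(v₁)). -/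
set_option autoImplicit false

namespace GTLD

/-- A partial bijection of `X`: a functional, injective relation on `X`.
It represents a bijection between its domain and its image. -/
structure PartialBij (X : Type*) where
  rel : X → X → Prop
  functional : ∀ ⦃x y y'⦄, rel x y → rel x y' → y = y'
  injective : ∀ ⦃x x' y⦄, rel x y → rel x' y → x = x'

namespace PartialBij

variable {X : Type*}

/-- The domain of a partial bijection. -/
def domSet (f : PartialBij X) : Set X :=
  {x | ∃ y, f.rel x y}

/-- The image of a partial bijection. -/
def imgSet (f : PartialBij X) : Set X :=
  {y | ∃ x, f.rel x y}

/-- The image of a set under a partial bijection. -/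
def image (f : PartialBij X) (A : Set X) : Set X :=
  {y | ∃ x ∈ A, f.rel x y}

/-- Composition `g ∘ f` of partial bijections (first apply `f`, then `g`);
this is the composition `g ∘ f : f⁻¹(B ∩ C) → g(B ∩ C)` of the paper. -/
def comp (g f : PartialBij X) : PartialBij X where
  rel := fun x z => ∃ y, f.rel x y ∧ g.rel y z
  functional := by
    rintro x z z' ⟨y, h1, h2⟩ ⟨y', h1', h2'⟩
    cases f.functional h1 h1'
    exact g.functional h2 h2'
  injective := by
    rintro x x' z ⟨y, h1, h2⟩ ⟨y', h1', h2'⟩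
    cases g.injective h2 h2'
    exact f.injective h1 h1'

/-- The inverse of a partial bijection. -/
def inv (f : PartialBij X) : PartialBij X where
  rel := fun x y => f.rel y x
  functional := by
    intro x y y' h h'
    exact f.injective h h'
  injective := by
    intro x x' y h h'
    exact f.functional h h'

/-- The restriction of a partial bijection to a subset. -/
def restrict (f : PartialBij X) (A : Set X) : PartialBij X where
  rel := fun x y => x ∈ A ∧ f.rel x y
  functional := by
    rintro x y y' ⟨_, h⟩ ⟨_, h'⟩
    exact f.functional h h'
  injective := by
    rintro x x' y ⟨_, h⟩ ⟨_, h'⟩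
    exact f.injective h h'

/-- The identity partial bijection on a subset `A ⊆ X`. -/
def idOn (A : Set X) : PartialBij X where
  rel := fun x y => x ∈ A ∧ x = y
  functional := by
    rintro x y y' ⟨_, h1⟩ ⟨_, h2⟩
    rw [← h1, ← h2]
  injective := by
    rintro x x' y ⟨_, h1⟩ ⟨_, h2⟩
    rw [h1, h2]

end PartialBij

variable {X : Type*}

/-- `D` is a domain for `S`: it is the domain of some element of `S`. -/
def IsDomain (S : Set (PartialBij X)) (D : Set X) : Prop :=
  ∃ s ∈ S, s.domSet = D

/-- `Y` is a finite disjoint union of domains. -/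
def FinDisjUnionOfDomains (S : Set (PartialBij X)) (Y : Set X) : Prop :=
  ∃ (n : ℕ) (D : Fin n → Set X), (∀ i, IsDomain S (D i)) ∧
    (∀ i j, i ≠ j → D i ∩ D j = ∅) ∧ (⋃ i, D i) = Y

/-- A partial bijection is locally determined by `S`: its domain and image admit
finite partitions into domains such that the restriction of the bijection to each
member of the first partition is an element of `S` mapping it bijectively onto the
corresponding member of the second. -/
def LocallyDetermined (S : Set (PartialBij X)) (f : PartialBij X) : Prop :=
  ∃ (m : ℕ) (t : Fin m → PartialBij X),
    (∀ i, t i ∈ S) ∧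
    (∀ i j, i ≠ j → (t i).domSet ∩ (t j).domSet = ∅) ∧
    (∀ i j, i ≠ j → (t i).imgSet ∩ (t j).imgSet = ∅) ∧
    (⋃ i, (t i).domSet) = f.domSet ∧
    (∀ x y, f.rel x y ↔ ∃ i, (t i).rel x y)

/-- Membership in the group `Γ_S`: a bijection of all of `X` that is
locally determined by `S`. -/
def MemGamma (S : Set (PartialBij X)) (γ : PartialBij X) : Prop :=
  γ.domSet = Set.univ ∧ γ.imgSet = Set.univ ∧ LocallyDetermined S γ

/-- `Pt` is a partition of `D` (into nonempty pieces). -/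
def IsPartitionOf (Pt : Set (Set X)) (D : Set X) : Prop :=
  ∅ ∉ Pt ∧ ⋃₀ Pt = D ∧ ∀ P ∈ Pt, ∀ Q ∈ Pt, P ≠ Q → P ∩ Q = ∅

/-- The set of domains of `S` has the compact ultrametric property:
intersecting domains are nested, and the complement of a domain is a finite
union of domains. -/
def CompactUltrametric (S : Set (PartialBij X)) : Prop :=
  (∀ D₁ D₂, IsDomain S D₁ → IsDomain S D₂ → (D₁ ∩ D₂).Nonempty →
    D₁ ⊆ D₂ ∨ D₂ ⊆ D₁) ∧
  (∀ D, IsDomain S D → ∃ (n : ℕ) (E : Fin n → Set X),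
    (∀ i, IsDomain S (E i)) ∧ (⋃ i, E i) = Dᶜ)

/-- `F` is the greatest proper nonempty subdomain of `D` containing `x`. -/
def IsGreatestProperSub (S : Set (PartialBij X)) (D F : Set X) (x : X) : Prop :=
  IsDomain S F ∧ x ∈ F ∧ F ⊂ D ∧
    ∀ F', IsDomain S F' → x ∈ F' → F' ⊂ D → F' ⊆ F

/-- `maxPart` assigns to each nonempty domain its maximal partition: the partition
into greatest proper nonempty subdomains, or `{D}` if `D` has no proper nonempty
subdomain. -/
def MaxPartSpec (S : Set (PartialBij X)) (maxPart : Set X → Set (Set X)) : Prop :=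
  ∀ D, IsDomain S D → D.Nonempty →
    ((∃ F, IsDomain S F ∧ F.Nonempty ∧ F ⊂ D) →
      maxPart D = {F | ∃ x ∈ D, IsGreatestProperSub S D F x}) ∧
    ((¬ ∃ F, IsDomain S F ∧ F.Nonempty ∧ F ⊂ D) → maxPart D = {D})

/-- An `S`-structure: a structure function `str` assigning structure sets to pairs
of nonempty domains, and a pattern function `pat` assigning sets of patterns
(finite partitions into domains) to nonempty domains, subject to the axioms
(P1)-(P5) and (S1)-(S6). -/
structure SStructure (S : Set (PartialBij X)) where
  str : Set X → Set X → Set (PartialBij X)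
  pat : Set X → Set (Set (Set X))
  /-- (P1) the trivial partition is a pattern -/
  pat_trivial : ∀ D, IsDomain S D → D.Nonempty → {D} ∈ pat D
  /-- (P2) each pattern is a finite partition of `D` into domains -/
  pat_partition : ∀ D, IsDomain S D → D.Nonempty → ∀ Pt ∈ pat D,
    Pt.Finite ∧ IsPartitionOf Pt D ∧ ∀ P ∈ Pt, IsDomain S P
  /-- (P3) restriction -/
  pat_restrict : ∀ D E, IsDomain S D → D.Nonempty → IsDomain S E → E.Nonempty →
    E ⊆ D → ∀ Pt ∈ pat D, {Q | ∃ P ∈ Pt, (P ∩ E).Nonempty ∧ Q = P ∩ E} ∈ pat E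
  /-- (P4) patchwork -/
  pat_patchwork : ∀ D, IsDomain S D → D.Nonempty → ∀ Pt ∈ pat D,
    ∀ F : Set X → Set (Set X), (∀ P ∈ Pt, F P ∈ pat P) →
    {Q | ∃ P ∈ Pt, Q ∈ F P} ∈ pat D
  /-- (P5) cofinality -/
  pat_cofinal : ∀ D, IsDomain S D → D.Nonempty →
    ∀ Pt' : Set (Set X), Pt'.Finite → IsPartitionOf Pt' D →
    (∀ P ∈ Pt', IsDomain S P) →
    ∃ Pt ∈ pat D, ∀ P ∈ Pt, ∃ P' ∈ Pt', P ⊆ P'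
  /-- (S1) elements of `str D₁ D₂` lie in `S`, with domain `D₁` and image `D₂` -/
  str_mem : ∀ D₁ D₂, ∀ s ∈ str D₁ D₂, s ∈ S ∧ s.domSet = D₁ ∧ s.imgSet = D₂
  /-- (S2) identities -/
  str_id : ∀ D, IsDomain S D → D.Nonempty → PartialBij.idOn D ∈ str D D
  /-- (S3) inverses -/
  str_inv : ∀ D₁ D₂, ∀ s ∈ str D₁ D₂, PartialBij.inv s ∈ str D₂ D₁
  /-- (S4) compositions -/
  str_comp : ∀ D₁ D₂ D₃, ∀ s₁ ∈ str D₁ D₂, ∀ s₂ ∈ str D₂ D₃,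
    PartialBij.comp s₂ s₁ ∈ str D₁ D₃
  /-- (S5) generation -/
  generation : ∀ f : PartialBij X, IsDomain S f.domSet → f.domSet.Nonempty →
    LocallyDetermined S f →
    ∃ Pt ∈ pat f.domSet, ∀ E ∈ Pt,
      f.restrict E ∈ S ∧ f.restrict E ∈ str E (f.image E)
  /-- (S6) `𝕊`-invariance of `ℙ` -/
  pat_invariant : ∀ D₁ D₂, IsDomain S D₁ → D₁.Nonempty → ∀ Pt ∈ pat D₁,
    ∀ s ∈ str D₁ D₂, {Q | ∃ P ∈ Pt, Q = PartialBij.image s P} ∈ pat D₂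

/-- The maximal `S`-structure: the structure sets are all elements of `S` with the
given domain and image, and the patterns are all finite partitions into domains. -/
def IsMaximalSStructure {S : Set (PartialBij X)} (SS : SStructure S) : Prop :=
  (∀ D₁ D₂, IsDomain S D₁ → D₁.Nonempty → IsDomain S D₂ → D₂.Nonempty →
    SS.str D₁ D₂ = {s | s ∈ S ∧ s.domSet = D₁ ∧ s.imgSet = D₂}) ∧
  (∀ D, IsDomain S D → D.Nonempty →
    SS.pat D = {Pt | Pt.Finite ∧ IsPartitionOf Pt D ∧ ∀ P ∈ Pt, IsDomain S P})

/-- `f` is (a representative of) an element `[f, D]` of `ℬ`: its domain is a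
nonempty domain and it is locally determined by `S`. -/
def IsSPair (S : Set (PartialBij X)) (f : PartialBij X) : Prop :=
  IsDomain S f.domSet ∧ f.domSet.Nonempty ∧ LocallyDetermined S f

/-- The fundamental equivalence relation on pairs: `(f, D₁) ∼ (g, D₂)` iff
`f = g ∘ h` for some `h ∈ 𝕊(D₁, D₂)`. -/
def PairRel {S : Set (PartialBij X)} (SS : SStructure S) (f g : PartialBij X) : Prop :=
  ∃ h ∈ SS.str f.domSet g.domSet, f = PartialBij.comp g h

/-- A pseudovertex: a nonempty finite set of (representatives of) elements of `ℬ`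
whose images are pairwise disjoint. -/
def IsPseudovertex (S : Set (PartialBij X)) (v : Set (PartialBij X)) : Prop :=
  v.Finite ∧ v.Nonempty ∧ (∀ f ∈ v, IsSPair S f) ∧
    ∀ f ∈ v, ∀ g ∈ v, f ≠ g → f.imgSet ∩ g.imgSet = ∅

/-- The image of a pseudovertex. -/
def PVImage (v : Set (PartialBij X)) : Set X :=
  ⋃ f ∈ v, f.imgSet

/-- Two (representative sets of) pseudovertices are equal as sets of equivalence
classes. -/
def PVEquiv {S : Set (PartialBij X)} (SS : SStructure S)
    (v w : Set (PartialBij X)) : Prop :=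
  (∀ f ∈ v, ∃ g ∈ w, PairRel SS f g) ∧ (∀ g ∈ w, ∃ f ∈ v, PairRel SS f g)

/-- An expansion of a pseudovertex `v` at an element `f ∈ v`: replace `f` by the
pieces `(f ∘ h)|_E` for `E` in a nontrivial pattern `Pt` of a domain `D̂`, where
`h ∈ 𝕊(D̂, dom f)`. -/
def Expansion {S : Set (PartialBij X)} (SS : SStructure S)
    (v v' : Set (PartialBij X)) : Prop :=
  ∃ f ∈ v, ∃ (Dh : Set X) (h : PartialBij X) (Pt : Set (Set X)),
    h ∈ SS.str Dh f.domSet ∧ Pt ∈ SS.pat Dh ∧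
    (∃ P ∈ Pt, ∃ Q ∈ Pt, P ≠ Q) ∧
    v' = (v \ {f}) ∪ {g | ∃ E ∈ Pt, g = (PartialBij.comp f h).restrict E}

/-- The partial order on pseudovertices induced by expansion (at the level of
sets of equivalence classes): `v ≤ w` iff a finite (possibly empty) sequence of
expansions leads from `v` to a pseudovertex equal to `w` as a set of classes. -/
def PVLE {S : Set (PartialBij X)} (SS : SStructure S)
    (v w : Set (PartialBij X)) : Prop :=
  ∃ w', Relation.ReflTransGen (Expansion SS) v w' ∧ PVEquiv SS w' w

/-- Strict version of `PVLE`. -/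
def PVLT {S : Set (PartialBij X)} (SS : SStructure S)
    (v w : Set (PartialBij X)) : Prop :=
  PVLE SS v w ∧ ¬ PVEquiv SS v w

/-- The action of a partial bijection `s` on a pseudovertex:
`s · {[f₁,D₁],…,[fₘ,Dₘ]} = {[s∘f₁,D₁],…,[s∘fₘ,Dₘ]}`. -/
def PVAct (s : PartialBij X) (v : Set (PartialBij X)) : Set (PartialBij X) :=
  (fun f => PartialBij.comp s f) '' v

/-- Two pseudovertices have the same type: there is a bijection between them
matching domains of the same domain type. -/
def SameType {S : Set (PartialBij X)} (SS : SStructure S)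
    (v w : Set (PartialBij X)) : Prop :=
  ∃ φ : PartialBij X → PartialBij X, Set.BijOn φ v w ∧
    ∀ f ∈ v, (SS.str f.domSet (φ f).domSet).Nonempty

/-- The stabilizer of a pseudovertex `v` in `Γ_S`. -/
def PVStab {S : Set (PartialBij X)} (SS : SStructure S)
    (v : Set (PartialBij X)) : Set (PartialBij X) :=
  {γ | MemGamma S γ ∧ PVEquiv SS (PVAct γ v) v}

/-- The subgroup of the stabilizer fixing each class `[f, D] ∈ v`. -/
def PVStabFix {S : Set (PartialBij X)} (SS : SStructure S)
    (v : Set (PartialBij X)) : Set (PartialBij X) :=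
  {γ | MemGamma S γ ∧ ∀ f ∈ v, PairRel SS (PartialBij.comp γ f) f}

/-- `Pt₁ ⪯ Pt₂`: the partition `Pt₂` is obtained from `Pt₁` by replacing each
member `D` of `Pt₁` by a pattern of `D`. -/
def PatRefines {S : Set (PartialBij X)} (SS : SStructure S)
    (Pt₁ Pt₂ : Set (Set X)) : Prop :=
  ∃ F : Set X → Set (Set X), (∀ D ∈ Pt₁, F D ∈ SS.pat D) ∧
    Pt₂ = {Q | ∃ D ∈ Pt₁, Q ∈ F D}

/-- A simple expansion: an expansion using the maximal partition. -/
def SimpleExpansion {S : Set (PartialBij X)} (SS : SStructure S)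
    (maxPart : Set X → Set (Set X)) (v v' : Set (PartialBij X)) : Prop :=
  ∃ f ∈ v, ∃ (Dh : Set X) (h : PartialBij X),
    h ∈ SS.str Dh f.domSet ∧
    (∃ P ∈ maxPart Dh, ∃ Q ∈ maxPart Dh, P ≠ Q) ∧
    v' = (v \ {f}) ∪ {g | ∃ E ∈ maxPart Dh, g = (PartialBij.comp f h).restrict E}

/-- `v'` is the result of `ℰ`-expansion from `v`. -/
def EExpansionFrom (E : PartialBij X → Set (Set (PartialBij X)))
    (v v' : Set (PartialBij X)) : Prop :=
  ∃ F : PartialBij X → Set (PartialBij X),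
    (∀ f ∈ v, F f ∈ E f) ∧ v' = ⋃ f ∈ v, F f

/-- `E` is an expansion scheme: conditions (1)-(4) of Definition 6.1. -/
def IsExpansionScheme {S : Set (PartialBij X)} (SS : SStructure S)
    (E : PartialBij X → Set (Set (PartialBij X))) : Prop :=
  ∀ f : PartialBij X, IsSPair S f →
    (∀ w ∈ E f, IsPseudovertex S w ∧ PVLE SS {f} w) ∧
    ({f} ∈ E f) ∧
    (∀ s : PartialBij X, LocallyDetermined S s → f.imgSet ⊆ s.domSet →
      (∀ w ∈ E f, ∃ w' ∈ E (PartialBij.comp s f), PVEquiv SS (PVAct s w) w') ∧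
      (∀ w' ∈ E (PartialBij.comp s f), ∃ w ∈ E f, PVEquiv SS (PVAct s w) w')) ∧
    (∀ w₁ ∈ E f, ∀ w₂ ∈ E f, PVLE SS w₁ w₂ → EExpansionFrom E w₁ w₂)

/-- An `ℰ`-chain: a strictly increasing sequence of pseudovertices, each of which
is the result of `ℰ`-expansion from the first. -/
def IsEChain {S : Set (PartialBij X)} (SS : SStructure S)
    (E : PartialBij X → Set (Set (PartialBij X)))
    (m : ℕ) (c : Fin (m + 1) → Set (PartialBij X)) : Prop :=
  (∀ i, IsPseudovertex S (c i)) ∧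
  (∀ i j : Fin (m + 1), i < j → PVLT SS (c i) (c j)) ∧
  (∀ i, EExpansionFrom E (c 0) (c i))

end GTLD

namespace GTLD

theorem PartialBij.ext_rel {X : Type*} {f g : PartialBij X}
    (h : ∀ x y, f.rel x y ↔ g.rel x y) : f = g := by
  cases f with | mk r1 a b => cases g with | mk r2 c d =>
  have : r1 = r2 := by
    funext x y
    exact propext (h x y)
  subst this
  rfl

theorem comp_dom {X : Type*} {s f : PartialBij X} (h : f.imgSet ⊆ s.domSet) :
    (PartialBij.comp s f).domSet = f.domSet := by
  ext x
  constructor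
  · rintro ⟨z, y, h1, _⟩
    exact ⟨y, h1⟩
  · rintro ⟨y, h1⟩
    obtain ⟨z, hz⟩ := h ⟨x, h1⟩
    exact ⟨z, y, h1, hz⟩

theorem comp_inj {X : Type*} {s f g : PartialBij X} (hf : f.imgSet ⊆ s.domSet)
    (hg : g.imgSet ⊆ s.domSet) (h : PartialBij.comp s f = PartialBij.comp s g) : f = g := by
  apply PartialBij.ext_rel
  intro x y
  constructor
  · intro h1
    obtain ⟨z, hz⟩ := hf ⟨x, h1⟩
    have h2 : (PartialBij.comp s f).rel x z := ⟨y, h1, hz⟩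
    rw [h] at h2
    obtain ⟨y', h3, h4⟩ := h2
    rwa [s.injective hz h4]
  · intro h1
    obtain ⟨z, hz⟩ := hg ⟨x, h1⟩
    have h2 : (PartialBij.comp s g).rel x z := ⟨y, h1, hz⟩
    rw [← h] at h2
    obtain ⟨y', h3, h4⟩ := h2
    rwa [s.injective hz h4]

theorem comp_assoc' {X : Type*} (s f h : PartialBij X) :
    PartialBij.comp s (PartialBij.comp f h) = PartialBij.comp (PartialBij.comp s f) h := by
  apply PartialBij.ext_rel
  intro x y
  constructor
  · rintro ⟨a, ⟨b, h1, h2⟩, h3⟩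
    exact ⟨b, h1, a, h2, h3⟩
  · rintro ⟨b, h1, a, h2, h3⟩
    exact ⟨a, ⟨b, h1, h2⟩, h3⟩

theorem comp_restrict {X : Type*} (s f : PartialBij X) (E : Set X) :
    PartialBij.comp s (f.restrict E) = (PartialBij.comp s f).restrict E := by
  apply PartialBij.ext_rel
  intro x y
  constructor
  · rintro ⟨a, ⟨h1, h2⟩, h3⟩
    exact ⟨h1, a, h2, h3⟩
  · rintro ⟨h1, a, h2, h3⟩
    exact ⟨a, ⟨h1, h2⟩, h3⟩

theorem img_sub {X : Type*} {v : Set (PartialBij X)} {f : PartialBij X} (hf : f ∈ v)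
    {A : Set X} (h : PVImage v ⊆ A) : f.imgSet ⊆ A := fun y hy =>
  h (Set.mem_biUnion hf hy)

theorem pairRel_img {X : Type*} {S : Set (PartialBij X)} {SS : SStructure S}
    {f g : PartialBij X} (h : PairRel SS f g) : g.imgSet ⊆ f.imgSet := by
  obtain ⟨k, hk, he⟩ := h
  obtain ⟨_, _, him⟩ := SS.str_mem _ _ k hk
  rintro y ⟨x, hx⟩
  have : x ∈ k.imgSet := by
    rw [him]
    exact ⟨y, hx⟩
  obtain ⟨w, hw⟩ := this
  rw [he]
  exact ⟨w, x, hw, hx⟩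

theorem pairRel_act {X : Type*} {S : Set (PartialBij X)} {SS : SStructure S}
    {s f g : PartialBij X} (hf : f.imgSet ⊆ s.domSet) (h : PairRel SS f g) :
    PairRel SS (PartialBij.comp s f) (PartialBij.comp s g) := by
  have hg := (pairRel_img h).trans hf
  obtain ⟨k, hk, he⟩ := h
  refine ⟨k, ?_, ?_⟩
  · rw [comp_dom hf, comp_dom hg]
    exact hk
  · rw [← comp_assoc', ← he]

theorem pvEquiv_act {X : Type*} {S : Set (PartialBij X)} {SS : SStructure S}
    {s : PartialBij X} {v w : Set (PartialBij X)} (hv : PVImage v ⊆ s.domSet)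
    (h : PVEquiv SS v w) : PVEquiv SS (PVAct s v) (PVAct s w) := by
  constructor
  · rintro _ ⟨f, hf, rfl⟩
    obtain ⟨g, hg, hfg⟩ := h.1 f hf
    exact ⟨_, ⟨g, hg, rfl⟩, pairRel_act (img_sub hf hv) hfg⟩
  · rintro _ ⟨g, hg, rfl⟩
    obtain ⟨f, hf, hfg⟩ := h.2 g hg
    exact ⟨_, ⟨f, hf, rfl⟩, pairRel_act (img_sub hf hv) hfg⟩

theorem expansion_img {X : Type*} {S : Set (PartialBij X)} {SS : SStructure S}
    {v w : Set (PartialBij X)} (h : Expansion SS v w) : PVImage w ⊆ PVImage v := by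
  obtain ⟨f, hf, Dh, k, Pt, hk, hPt, hne, rfl⟩ := h
  intro y hy
  simp only [PVImage, Set.mem_iUnion] at hy ⊢
  obtain ⟨g, hg, hy⟩ := hy
  rcases hg with hg | ⟨E, hE, rfl⟩
  · exact ⟨g, hg.1, hy⟩
  · obtain ⟨x, _, a, _, ha⟩ := hy
    exact ⟨f, hf, a, ha⟩

theorem expansion_act {X : Type*} {S : Set (PartialBij X)} {SS : SStructure S}
    {s : PartialBij X} {v w : Set (PartialBij X)} (hv : PVImage v ⊆ s.domSet)
    (h : Expansion SS v w) : Expansion SS (PVAct s v) (PVAct s w) := by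
  obtain ⟨f, hf, Dh, k, Pt, hk, hPt, hne, rfl⟩ := h
  refine ⟨PartialBij.comp s f, ⟨f, hf, rfl⟩, Dh, k, Pt, ?_, hPt, hne, ?_⟩
  · rw [comp_dom (img_sub hf hv)]
    exact hk
  · ext g
    constructor
    · rintro ⟨g, hg | ⟨E, hE, rfl⟩, rfl⟩
      · refine Or.inl ⟨⟨g, hg.1, rfl⟩, fun he => hg.2 ?_⟩
        exact comp_inj (img_sub hg.1 hv) (img_sub hf hv) he
      · refine Or.inr ⟨E, hE, ?_⟩
        rw [← comp_assoc']
        exact comp_restrict _ _ _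
    · rintro (⟨⟨g, hg, rfl⟩, hne⟩ | ⟨E, hE, rfl⟩)
      · refine ⟨g, Or.inl ⟨hg, fun he => hne ?_⟩, rfl⟩
        have he' : g = f := he
        rw [he']
        rfl
      · refine ⟨_, Or.inr ⟨E, hE, rfl⟩, ?_⟩
        rw [← comp_assoc']
        exact comp_restrict _ _ _

theorem locDet_comp {X : Type*} {S : Set (PartialBij X)}
    (hcomp : ∀ f ∈ S, ∀ g ∈ S, PartialBij.comp g f ∈ S) {s f : PartialBij X}
    (hs : LocallyDetermined S s) (hf : LocallyDetermined S f) :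
    LocallyDetermined S (PartialBij.comp s f) := by
  obtain ⟨n, u, uS, ud, ui, _, ur⟩ := hs
  obtain ⟨m, t, tS, td, ti, _, tr⟩ := hf
  have key : ∀ x y, (PartialBij.comp s f).rel x y ↔
      ∃ p : Fin (m * n), (PartialBij.comp (u (finProdFinEquiv.symm p).2)
        (t (finProdFinEquiv.symm p).1)).rel x y := by
    intro x y
    constructor
    · rintro ⟨a, h1, h2⟩
      obtain ⟨i, hi⟩ := (tr _ _).1 h1
      obtain ⟨j, hj⟩ := (ur _ _).1 h2
      refine ⟨finProdFinEquiv (i, j), ?_⟩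
      rw [Equiv.symm_apply_apply]
      exact ⟨a, hi, hj⟩
    · rintro ⟨p, a, h1, h2⟩
      exact ⟨a, (tr _ _).2 ⟨_, h1⟩, (ur _ _).2 ⟨_, h2⟩⟩
  have tdj : ∀ i j x y y', (t i).rel x y → (t j).rel x y' → i = j := by
    intro i j x y y' h h'
    by_contra hne
    exact (td i j hne).subset ⟨⟨y, h⟩, ⟨y', h'⟩⟩
  have tij : ∀ i j x x' y, (t i).rel x y → (t j).rel x' y → i = j := by
    intro i j x x' y h h'
    by_contra hne
    exact (ti i j hne).subset ⟨⟨x, h⟩, ⟨x', h'⟩⟩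
  have udj : ∀ i j x y y', (u i).rel x y → (u j).rel x y' → i = j := by
    intro i j x y y' h h'
    by_contra hne
    exact (ud i j hne).subset ⟨⟨y, h⟩, ⟨y', h'⟩⟩
  have uij : ∀ i j x x' y, (u i).rel x y → (u j).rel x' y → i = j := by
    intro i j x x' y h h'
    by_contra hne
    exact (ui i j hne).subset ⟨⟨x, h⟩, ⟨x', h'⟩⟩
  refine ⟨m * n, fun p => PartialBij.comp (u (finProdFinEquiv.symm p).2)
        (t (finProdFinEquiv.symm p).1), fun p => hcomp _ (tS _) _ (uS _), ?_, ?_, ?_, key⟩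
  · intro p q hpq
    rw [Set.eq_empty_iff_forall_notMem]
    rintro x ⟨⟨y, a, h1, h2⟩, ⟨y', a', h1', h2'⟩⟩
    apply hpq
    apply finProdFinEquiv.symm.injective
    have e1 := tdj _ _ _ _ _ h1 h1'
    have ea : a = a' := f.functional ((tr _ _).2 ⟨_, h1⟩) ((tr _ _).2 ⟨_, h1'⟩)
    subst ea
    exact Prod.ext e1 (udj _ _ _ _ _ h2 h2')
  · intro p q hpq
    rw [Set.eq_empty_iff_forall_notMem]
    rintro y ⟨⟨x, a, h1, h2⟩, ⟨x', a', h1', h2'⟩⟩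
    apply hpq
    apply finProdFinEquiv.symm.injective
    have e1 := uij _ _ _ _ _ h2 h2'
    have ea : a = a' := s.injective ((ur _ _).2 ⟨_, h2⟩) ((ur _ _).2 ⟨_, h2'⟩)
    subst ea
    exact Prod.ext (tij _ _ _ _ _ h1 h1') e1
  · ext x
    rw [Set.mem_iUnion]
    constructor
    · rintro ⟨p, y, h⟩
      exact ⟨y, (key x y).2 ⟨p, h⟩⟩
    · rintro ⟨y, h⟩
      obtain ⟨p, hp⟩ := (key x y).1 h
      exact ⟨p, y, hp⟩

/-- the partial action of `Ŝ` on pseudovertices is well defined,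
order-preserving, and satisfies `im(ŝ·v) = ŝ(im v)`. -/
theorem statement12 {X : Type*} (S : Set (PartialBij X))
    (hcomp : ∀ f ∈ S, ∀ g ∈ S, PartialBij.comp g f ∈ S)
    (hinv : ∀ f ∈ S, PartialBij.inv f ∈ S)
    (SS : SStructure S)
    (v₁ v₂ : Set (PartialBij X)) (s : PartialBij X)
    (h₁ : IsPseudovertex S v₁) (h₂ : IsPseudovertex S v₂)
    (hle : PVLE SS v₁ v₂)
    (hs : LocallyDetermined S s) (hdom : PVImage v₁ ⊆ s.domSet) :
    (IsPseudovertex S (PVAct s v₁) ∧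
      ∀ w : Set (PartialBij X), IsPseudovertex S w → PVEquiv SS v₁ w →
        PVEquiv SS (PVAct s v₁) (PVAct s w)) ∧
    PVLE SS (PVAct s v₁) (PVAct s v₂) ∧
    PVImage (PVAct s v₁) = PartialBij.image s (PVImage v₁) := by
  refine ⟨⟨⟨h₁.1.image _, h₁.2.1.image _, ?_, ?_⟩, fun w _ hw => pvEquiv_act hdom hw⟩, ?_, ?_⟩
  · rintro _ ⟨f, hf, rfl⟩
    obtain ⟨h1, h2, h3⟩ := h₁.2.2.1 f hf
    have hd := comp_dom (img_sub hf hdom)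
    refine ⟨?_, ?_, locDet_comp hcomp hs h3⟩
    · show IsDomain S (PartialBij.comp s f).domSet
      rwa [hd]
    · show (PartialBij.comp s f).domSet.Nonempty
      rwa [hd]
  · rintro _ ⟨f, hf, rfl⟩ _ ⟨g, hg, rfl⟩ hne
    rw [Set.eq_empty_iff_forall_notMem]
    rintro y ⟨⟨x, a, h1, h2⟩, ⟨x', a', h1', h2'⟩⟩
    have ea : a = a' := s.injective h2 h2'
    subst ea
    refine (h₁.2.2.2 f hf g hg ?_).subset ⟨⟨x, h1⟩, ⟨x', h1'⟩⟩
    rintro rfl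
    exact hne rfl
  · obtain ⟨w, hw, he⟩ := hle
    have : Relation.ReflTransGen (Expansion SS) (PVAct s v₁) (PVAct s w) ∧
        PVImage w ⊆ s.domSet := by
      clear he
      induction hw with
      | refl => exact ⟨.refl, hdom⟩
      | tail _ hb ih =>
        exact ⟨ih.1.tail (expansion_act ih.2 hb), (expansion_img hb).trans ih.2⟩
    exact ⟨_, this.1, pvEquiv_act this.2 he⟩
  · ext y
    simp only [PVImage, PVAct, Set.mem_iUnion]
    constructor
    · rintro ⟨_, ⟨f, hf, rfl⟩, x, a, h1, h2⟩
      exact ⟨a, Set.mem_biUnion hf ⟨x, h1⟩, h2⟩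
    · rintro ⟨a, ha, h2⟩
      simp only [Set.mem_iUnion] at ha
      obtain ⟨f, hf, x, h1⟩ := ha
      exact ⟨_, ⟨f, hf, rfl⟩, x, a, h1, h2⟩


end GTLD
end

section
/- Fix an S-structure (𝕊, ℙ). For every pseudovertex v = {[f₁,D₁],…,[fₘ,Dₘ]} there exists a pseudovertex v' with v ≤ v' of the form v' = {[id_{E₁},E₁],…,[id_{Eₙ},Eₙ]}, where {E₁,…,Eₙ} is a finite partition of im(v) into domains. -/
set_option autoImplicit false

namespace GTLD


theorem chain_aux {X : Type*} (S : Set (PartialBij X)) (SS : SStructure S)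
    (v : Set (PartialBij X)) (hv : IsPseudovertex S v)
    (P : PartialBij X → Set (Set X))
    (hP : ∀ f ∈ v, P f ∈ SS.pat f.domSet) (T : Set (PartialBij X)) (hT : T.Finite) :
    T ⊆ v → Relation.ReflTransGen (Expansion SS) v
      ((v \ T) ∪ {g | ∃ f ∈ T, ∃ E ∈ P f, g = f.restrict E}) := by
  obtain ⟨-, -, hS, hd⟩ := hv
  induction T, hT using Set.Finite.induction_on with
  | empty =>
    intro _
    have : (v \ ∅) ∪ {g | ∃ f ∈ (∅ : Set (PartialBij X)), ∃ E ∈ P f, g = f.restrict E} = v := by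
      ext; simp
    rw [this]
  | @insert a T haT hT ih =>
    intro hsub
    have hav : a ∈ v := hsub (Set.mem_insert _ _)
    have hTv : T ⊆ v := fun x hx => hsub (Set.mem_insert_of_mem _ hx)
    have ih := ih hTv
    obtain ⟨hdom, hne, -⟩ := hS a hav
    obtain ⟨-, ⟨hem, hun, -⟩, -⟩ := SS.pat_partition _ hdom hne _ (hP a hav)
    have hnot : ∀ f ∈ T, ∀ E ∈ P f, a ≠ f.restrict E := by
      rintro f hf E hE h
      obtain ⟨x, y, hxy⟩ := hne
      have h2 : f.rel x y := by rw [h] at hxy; exact hxy.2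
      have hfa : f ≠ a := fun e => haT (e ▸ hf)
      have h3 := hd f (hTv hf) a hav hfa
      have : y ∈ f.imgSet ∩ a.imgSet := ⟨⟨x, h2⟩, ⟨x, hxy⟩⟩
      rw [h3] at this; exact this
    set w := (v \ T) ∪ {g | ∃ f ∈ T, ∃ E ∈ P f, g = f.restrict E} with hw
    have haw : a ∈ w := Or.inl ⟨hav, haT⟩
    have key : (v \ insert a T) ∪ {g | ∃ f ∈ insert a T, ∃ E ∈ P f, g = f.restrict E}
        = (w \ {a}) ∪ {g | ∃ E ∈ P a, g = a.restrict E} := by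
      ext g
      simp only [hw, Set.mem_union, Set.mem_diff, Set.mem_insert_iff, Set.mem_setOf_eq,
        Set.mem_singleton_iff]
      constructor
      · rintro (⟨h1, h2⟩ | ⟨f, rfl | hf, E, hE, rfl⟩)
        · exact Or.inl ⟨Or.inl ⟨h1, fun h => h2 (Or.inr h)⟩, fun h => h2 (Or.inl h)⟩
        · exact Or.inr ⟨E, hE, rfl⟩
        · exact Or.inl ⟨Or.inr ⟨f, hf, E, hE, rfl⟩, fun h => hnot f hf E hE h.symm⟩
      · rintro (⟨⟨h1, h2⟩ | ⟨f, hf, E, hE, rfl⟩, h3⟩ | ⟨E, hE, rfl⟩)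
        · exact Or.inl ⟨h1, fun h => h.elim h3 h2⟩
        · exact Or.inr ⟨f, Or.inr hf, E, hE, rfl⟩
        · exact Or.inr ⟨a, Or.inl rfl, E, hE, rfl⟩
    rw [key]
    by_cases hnt : ∃ A ∈ P a, ∃ B ∈ P a, A ≠ B
    · refine ih.tail ⟨a, haw, a.domSet, PartialBij.idOn a.domSet, P a, SS.str_id _ hdom hne,
        hP a hav, hnt, ?_⟩
      have : PartialBij.comp a (PartialBij.idOn a.domSet) = a := by
        apply PartialBij.ext_rel
        intro x y
        constructor
        · rintro ⟨z, ⟨_, rfl⟩, h⟩; exact h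
        · intro h; exact ⟨x, ⟨⟨y, h⟩, rfl⟩, h⟩
      rw [this]
    · push Not at hnt
      have hall : ∀ A ∈ P a, A = a.domSet := by
        intro A hA
        rw [← hun]
        apply Set.Subset.antisymm
        · exact Set.subset_sUnion_of_mem hA
        · rintro x ⟨B, hB, hx⟩
          rw [hnt A hA B hB]; exact hx
      have hmem : a.domSet ∈ P a := by
        obtain ⟨x, hx⟩ := hne
        rw [← hun] at hx
        obtain ⟨B, hB, -⟩ := hx
        rw [← hall B hB]; exact hB
      have hra : a.restrict a.domSet = a := by
        apply PartialBij.ext_rel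
        intro x y
        exact ⟨fun h => h.2, fun h => ⟨⟨y, h⟩, h⟩⟩
      have : (w \ {a}) ∪ {g | ∃ E ∈ P a, g = a.restrict E} = w := by
        ext g
        simp only [Set.mem_union, Set.mem_diff, Set.mem_singleton_iff, Set.mem_setOf_eq]
        constructor
        · rintro (h | ⟨E, hE, rfl⟩)
          · exact h.1
          · rw [hall E hE, hra]; exact haw
        · intro h
          by_cases hga : g = a
          · right; exact ⟨_, hmem, by rw [hra, hga]⟩
          · exact Or.inl ⟨h, hga⟩
      rw [this]
      exact ih

/-- every pseudovertex `v` expands to a pseudovertex of the form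
`{[id_{E₁},E₁],…,[id_{Eₙ},Eₙ]}` where `{E₁,…,Eₙ}` is a finite partition of
`im(v)` into domains. -/
theorem statement13 {X : Type*} (S : Set (PartialBij X))
    (hcomp : ∀ f ∈ S, ∀ g ∈ S, PartialBij.comp g f ∈ S)
    (hinv : ∀ f ∈ S, PartialBij.inv f ∈ S)
    (SS : SStructure S)
    (v : Set (PartialBij X)) (hv : IsPseudovertex S v) :
    ∃ Pt : Set (Set X), Pt.Finite ∧ IsPartitionOf Pt (PVImage v) ∧
      (∀ E ∈ Pt, IsDomain S E) ∧
      PVLE SS v {g : PartialBij X | ∃ E ∈ Pt, g = PartialBij.idOn E} := by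
  have hgen : ∀ f : PartialBij X, ∃ Q : Set (Set X), f ∈ v → Q ∈ SS.pat f.domSet ∧
      ∀ E ∈ Q, f.restrict E ∈ S ∧ f.restrict E ∈ SS.str E (f.image E) := by
    intro f
    by_cases hf : f ∈ v
    · obtain ⟨h1, h2, h3⟩ := hv.2.2.1 f hf
      obtain ⟨Q, hQ, hE⟩ := SS.generation f h1 h2 h3
      exact ⟨Q, fun _ => ⟨hQ, hE⟩⟩
    · exact ⟨∅, fun h => absurd h hf⟩
  choose P hP using hgen
  have hpart : ∀ f ∈ v, (P f).Finite ∧ IsPartitionOf (P f) f.domSet ∧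
      ∀ A ∈ P f, IsDomain S A := fun f hf =>
    SS.pat_partition _ (hv.2.2.1 f hf).1 (hv.2.2.1 f hf).2.1 _ (hP f hf).1
  have hch := chain_aux S SS v hv P (fun f hf => (hP f hf).1) v hv.1 subset_rfl
  have hidrel : ∀ f ∈ v, ∀ E ∈ P f,
      PairRel SS (f.restrict E) (PartialBij.idOn (f.image E)) := by
    intro f hf E hE
    have hs := ((hP f hf).2 E hE).2
    have hdomE := (SS.str_mem _ _ _ hs).2.1
    have hdi : (PartialBij.idOn (f.image E)).domSet = f.image E := by
      ext x
      exact ⟨fun ⟨_, h, _⟩ => h, fun h => ⟨x, h, rfl⟩⟩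
    refine ⟨f.restrict E, ?_, ?_⟩
    · rw [hdi, hdomE]; exact hs
    · apply PartialBij.ext_rel
      intro x y
      constructor
      · intro h; exact ⟨y, h, ⟨x, h.1, h.2⟩, rfl⟩
      · rintro ⟨z, h, _, rfl⟩; exact h
  refine ⟨{Q | ∃ f ∈ v, ∃ E ∈ P f, Q = f.image E}, ?_, ⟨?_, ?_, ?_⟩, ?_, _, hch, ?_, ?_⟩
  · have : {Q | ∃ f ∈ v, ∃ E ∈ P f, Q = f.image E}
        = ⋃ f ∈ v, (fun E => f.image E) '' (P f) := by
      ext Q; simp [eq_comm]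
    rw [this]
    exact hv.1.biUnion fun f hf => (hpart f hf).1.image _
  · rintro ⟨f, hf, E, hE, h⟩
    obtain ⟨-, ⟨hem, hun, -⟩, -⟩ := hpart f hf
    have hEne : E.Nonempty := Set.nonempty_iff_ne_empty.2 fun h => hem (h ▸ hE)
    obtain ⟨x, hx⟩ := hEne
    have : x ∈ f.domSet := by rw [← hun]; exact ⟨E, hE, hx⟩
    obtain ⟨y, hy⟩ := this
    have : y ∈ f.image E := ⟨x, hx, hy⟩
    rw [← h] at this; exact this
  · ext y
    simp only [PVImage, Set.mem_sUnion, Set.mem_iUnion, Set.mem_setOf_eq]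
    constructor
    · rintro ⟨_, ⟨f, hf, E, hE, rfl⟩, x, hx, hxy⟩
      exact ⟨f, hf, x, hxy⟩
    · rintro ⟨f, hf, x, hxy⟩
      have : x ∈ f.domSet := ⟨y, hxy⟩
      rw [← (hpart f hf).2.1.2.1] at this
      obtain ⟨E, hE, hx⟩ := this
      exact ⟨_, ⟨f, hf, E, hE, rfl⟩, x, hx, hxy⟩
  · rintro _ ⟨f, hf, E, hE, rfl⟩ _ ⟨g, hg, F, hF, rfl⟩ hne
    apply Set.eq_empty_iff_forall_notMem.2
    rintro y ⟨⟨x, hx, hxy⟩, ⟨x', hx', hxy'⟩⟩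
    by_cases hfg : f = g
    · subst hfg
      cases f.injective hxy hxy'
      have hEF : E ≠ F := fun h => hne (by rw [h])
      have := (hpart f hf).2.1.2.2 E hE F hF hEF
      have h2 : x ∈ E ∩ F := ⟨hx, hx'⟩
      rw [this] at h2; exact h2
    · have h2 : y ∈ f.imgSet ∩ g.imgSet := ⟨⟨x, hxy⟩, ⟨x', hxy'⟩⟩
      rw [hv.2.2.2 f hf g hg hfg] at h2; exact h2
  · rintro _ ⟨f, hf, E, hE, rfl⟩
    obtain ⟨h1, h2, -⟩ := SS.str_mem _ _ _ (SS.str_inv _ _ _ ((hP f hf).2 E hE).2)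
    exact ⟨_, h1, h2⟩
  · rintro _ (⟨h1, h2⟩ | ⟨f, hf, E, hE, rfl⟩)
    · exact absurd h1 h2
    · exact ⟨_, ⟨_, ⟨f, hf, E, hE, rfl⟩, rfl⟩, hidrel f hf E hE⟩
  · rintro _ ⟨_, ⟨f, hf, E, hE, rfl⟩, rfl⟩
    exact ⟨_, Or.inr ⟨f, hf, E, hE, rfl⟩, hidrel f hf E hE⟩

end GTLD
end

section
/- Fix an S-structure (𝕊, ℙ), and assume X is a finite disjoint union of domains. Two vertices v₁, v₂ ∈ 𝒱_𝕊 (pseudovertices with image X) lie in the same Γ_S-orbit (under the action γ·{[f₁,D₁],…,[fₘ,Dₘ]} = {[γ∘f₁,D₁],…,[γ∘fₘ,Dₘ]}) if and only if they have the same type. More generally, two pseudovertices lie in the same Ŝ-orbit if and only if they have the same type. -/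
set_option autoImplicit false

namespace GTLD

theorem ld_intro {X : Type*} {S : Set (PartialBij X)} {f : PartialBij X} {ι : Type*} [Finite ι]
    (t : ι → PartialBij X) (hS : ∀ i, t i ∈ S)
    (hd : ∀ i j x y y', (t i).rel x y → (t j).rel x y' → i = j)
    (hi : ∀ i j x x' y, (t i).rel x y → (t j).rel x' y → i = j)
    (hr : ∀ x y, f.rel x y ↔ ∃ i, (t i).rel x y) : LocallyDetermined S f := by
  obtain ⟨n, ⟨e⟩⟩ := Finite.exists_equiv_fin ι
  refine ⟨n, fun k => t (e.symm k), fun k => hS _, ?_, ?_, ?_, ?_⟩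
  · intro i j hij
    ext x
    simp only [Set.mem_inter_iff, Set.mem_empty_iff_false, iff_false]
    rintro ⟨⟨y, h1⟩, ⟨y', h2⟩⟩
    exact hij (e.symm.injective (hd _ _ _ _ _ h1 h2))
  · intro i j hij
    ext x
    simp only [Set.mem_inter_iff, Set.mem_empty_iff_false, iff_false]
    rintro ⟨⟨y, h1⟩, ⟨y', h2⟩⟩
    exact hij (e.symm.injective (hi _ _ _ _ _ h1 h2))
  · ext x
    simp only [Set.mem_iUnion]
    constructor
    · rintro ⟨i, y, h⟩
      exact ⟨y, (hr x y).2 ⟨_, h⟩⟩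
    · rintro ⟨y, h⟩
      obtain ⟨i, h⟩ := (hr x y).1 h
      exact ⟨e i, y, by simpa using h⟩
  · intro x y
    rw [hr]
    constructor
    · rintro ⟨i, h⟩
      exact ⟨e i, by simpa using h⟩
    · rintro ⟨i, h⟩
      exact ⟨_, h⟩

theorem ld_elim {X : Type*} {S : Set (PartialBij X)} {f : PartialBij X}
    (h : LocallyDetermined S f) : ∃ (m : ℕ) (t : Fin m → PartialBij X), (∀ i, t i ∈ S) ∧
    (∀ i j x y y', (t i).rel x y → (t j).rel x y' → i = j) ∧
    (∀ i j x x' y, (t i).rel x y → (t j).rel x' y → i = j) ∧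
    (∀ x y, f.rel x y ↔ ∃ i, (t i).rel x y) := by
  obtain ⟨m, t, hS, hd, hi, -, hr⟩ := h
  refine ⟨m, t, hS, ?_, ?_, hr⟩
  · intro i j x y y' h1 h2
    by_contra hij
    have : x ∈ (t i).domSet ∩ (t j).domSet := ⟨⟨y, h1⟩, ⟨y', h2⟩⟩
    rw [hd i j hij] at this
    exact this
  · intro i j x x' y h1 h2
    by_contra hij
    have : y ∈ (t i).imgSet ∩ (t j).imgSet := ⟨⟨x, h1⟩, ⟨x', h2⟩⟩
    rw [hi i j hij] at this
    exact this

theorem ld_of_mem {X : Type*} {S : Set (PartialBij X)} {f : PartialBij X} (h : f ∈ S) :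
    LocallyDetermined S f :=
  ld_intro (ι := Unit) (fun _ => f) (fun _ => h) (fun _ _ _ _ _ _ _ => rfl)
    (fun _ _ _ _ _ _ _ => rfl) (by simp)

theorem ld_inv {X : Type*} {S : Set (PartialBij X)} (hinv : ∀ f ∈ S, PartialBij.inv f ∈ S)
    {f : PartialBij X} (h : LocallyDetermined S f) : LocallyDetermined S f.inv := by
  obtain ⟨m, t, hS, hd, hi, hr⟩ := ld_elim h
  exact ld_intro (fun i => (t i).inv) (fun i => hinv _ (hS i))
    (fun i j x y y' h1 h2 => hi i j y y' x h1 h2)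
    (fun i j x x' y h1 h2 => hd i j y x x' h1 h2)
    (fun x y => hr y x)

theorem ld_comp {X : Type*} {S : Set (PartialBij X)}
    (hcomp : ∀ f ∈ S, ∀ g ∈ S, PartialBij.comp g f ∈ S)
    {f g : PartialBij X} (hf : LocallyDetermined S f) (hg : LocallyDetermined S g) :
    LocallyDetermined S (g.comp f) := by
  obtain ⟨m, t, hS, hd, hi, hr⟩ := ld_elim hf
  obtain ⟨m', t', hS', hd', hi', hr'⟩ := ld_elim hg
  refine ld_intro (ι := Fin m × Fin m') (fun p => (t' p.2).comp (t p.1))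
    (fun p => hcomp _ (hS _) _ (hS' _)) ?_ ?_ ?_
  · rintro ⟨i, j⟩ ⟨i', j'⟩ x z z' ⟨y, h1, h2⟩ ⟨y', h1', h2'⟩
    have e := hd _ _ _ _ _ h1 h1'
    dsimp only at e h1 h1' h2 h2'
    subst e
    cases (t i).functional h1 h1'
    have e := hd' _ _ _ _ _ h2 h2'
    subst e
    rfl
  · rintro ⟨i, j⟩ ⟨i', j'⟩ x x' z ⟨y, h1, h2⟩ ⟨y', h1', h2'⟩
    have e := hi' _ _ _ _ _ h2 h2'
    dsimp only at e h1 h1' h2 h2'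
    subst e
    cases (t' j).injective h2 h2'
    have e := hi _ _ _ _ _ h1 h1'
    subst e
    rfl
  · intro x z
    constructor
    · rintro ⟨y, h1, h2⟩
      obtain ⟨i, h1⟩ := (hr _ _).1 h1
      obtain ⟨j, h2⟩ := (hr' _ _).1 h2
      exact ⟨(i, j), y, h1, h2⟩
    · rintro ⟨⟨i, j⟩, y, h1, h2⟩
      exact ⟨y, (hr _ _).2 ⟨i, h1⟩, (hr' _ _).2 ⟨j, h2⟩⟩

theorem ld_union {X : Type*} {S : Set (PartialBij X)} {f : PartialBij X} {ι : Type*} [Finite ι]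
    (t : ι → PartialBij X) (hS : ∀ i, LocallyDetermined S (t i))
    (hd : ∀ i j x y y', (t i).rel x y → (t j).rel x y' → i = j)
    (hi : ∀ i j x x' y, (t i).rel x y → (t j).rel x' y → i = j)
    (hr : ∀ x y, f.rel x y ↔ ∃ i, (t i).rel x y) : LocallyDetermined S f := by
  choose m u huS hud hui hur using fun i => ld_elim (hS i)
  refine ld_intro (ι := Σ i, Fin (m i)) (fun p => u p.1 p.2) (fun p => huS _ _) ?_ ?_ ?_
  · rintro ⟨i, k⟩ ⟨j, l⟩ x y y' h1 h2
    have e := hd i j x y y' ((hur _ _ _).2 ⟨k, h1⟩) ((hur _ _ _).2 ⟨l, h2⟩)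
    subst e
    have e := hud _ _ _ _ _ _ h1 h2
    dsimp only at e
    subst e
    rfl
  · rintro ⟨i, k⟩ ⟨j, l⟩ x y y' h1 h2
    have e := hi i j x y y' ((hur _ _ _).2 ⟨k, h1⟩) ((hur _ _ _).2 ⟨l, h2⟩)
    subst e
    have e := hui _ _ _ _ _ _ h1 h2
    dsimp only at e
    subst e
    rfl
  · intro x y
    rw [hr]
    constructor
    · rintro ⟨i, h⟩
      obtain ⟨k, h⟩ := (hur _ _ _).1 h
      exact ⟨⟨i, k⟩, h⟩
    · rintro ⟨⟨i, k⟩, h⟩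
      exact ⟨i, (hur _ _ _).2 ⟨k, h⟩⟩

theorem pv_unique {X : Type*} {S : Set (PartialBij X)} {v : Set (PartialBij X)}
    (hv : IsPseudovertex S v) {f g : PartialBij X} (hf : f ∈ v) (hg : g ∈ v) {x x' y : X}
    (h1 : f.rel x y) (h2 : g.rel x' y) : f = g := by
  by_contra hne
  have : y ∈ f.imgSet ∩ g.imgSet := ⟨⟨x, h1⟩, ⟨x', h2⟩⟩
  rw [hv.2.2.2 f hf g hg hne] at this
  exact this

theorem dom_comp {X : Type*} {s f : PartialBij X} (h : f.imgSet ⊆ s.domSet) :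
    (s.comp f).domSet = f.domSet := by
  ext x
  constructor
  · rintro ⟨z, y, h1, h2⟩
    exact ⟨y, h1⟩
  · rintro ⟨y, h1⟩
    obtain ⟨z, h2⟩ := h ⟨x, h1⟩
    exact ⟨z, y, h1, h2⟩

theorem sameType_of_orbit {X : Type*} {S : Set (PartialBij X)} (SS : SStructure S)
    {v w : Set (PartialBij X)} (hv : IsPseudovertex S v) (hw : IsPseudovertex S w)
    {s : PartialBij X} (hs : PVImage v ⊆ s.domSet) (he : PVEquiv SS (PVAct s v) w) :
    SameType SS v w := by
  have hsub : ∀ f ∈ v, f.imgSet ⊆ s.domSet := fun f hf y hy =>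
    hs (Set.mem_biUnion hf hy)
  -- the class of `s ∘ f` has the same image as `s ∘ f`
  have key : ∀ f g, PairRel SS (s.comp f) g → ∀ z,
      z ∈ (s.comp f).imgSet ↔ z ∈ g.imgSet := by
    rintro f g ⟨h, hh, e⟩ z
    obtain ⟨-, -, him⟩ := SS.str_mem _ _ h hh
    constructor
    · rintro ⟨x, hx⟩
      rw [e] at hx
      obtain ⟨y, -, h2⟩ := hx
      exact ⟨y, h2⟩
    · rintro ⟨y, hy⟩
      have : y ∈ h.imgSet := by rw [him]; exact ⟨z, hy⟩
      obtain ⟨x, hx⟩ := this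
      rw [e]
      exact ⟨x, y, hx, hy⟩
  have hne : ∀ f ∈ v, ∃ x y z, f.rel x y ∧ s.rel y z := by
    intro f hf
    obtain ⟨x, y, h1⟩ := (hv.2.2.1 f hf).2.1
    obtain ⟨z, h2⟩ := hsub f hf ⟨x, h1⟩
    exact ⟨x, y, z, h1, h2⟩
  have hex : ∀ f, ∃ g, f ∈ v → g ∈ w ∧ PairRel SS (s.comp f) g := by
    intro f
    by_cases hf : f ∈ v
    · obtain ⟨g, h1, h2⟩ := he.1 _ ⟨f, hf, rfl⟩
      exact ⟨g, fun _ => ⟨h1, h2⟩⟩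
    · exact ⟨f, fun h => absurd h hf⟩
  choose φ hφ using hex
  refine ⟨φ, ⟨fun f hf => (hφ f hf).1, ?_, ?_⟩, ?_⟩
  · intro f hf f' hf' e
    obtain ⟨x, y, z, h1, h2⟩ := hne f hf
    have hz := (key _ _ (hφ f hf).2 z).1 ⟨x, y, h1, h2⟩
    rw [e] at hz
    obtain ⟨x', y', h1', h2'⟩ := (key _ _ (hφ f' hf').2 z).2 hz
    cases s.injective h2 h2'
    exact pv_unique hv hf hf' h1 h1'
  · intro g hg
    obtain ⟨_, ⟨f, hf, rfl⟩, hr⟩ := he.2 g hg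
    refine ⟨f, hf, ?_⟩
    obtain ⟨x, y, z, h1, h2⟩ := hne f hf
    obtain ⟨a, ha⟩ := (key _ _ (hφ f hf).2 z).1 ⟨x, y, h1, h2⟩
    obtain ⟨b, hb⟩ := (key _ _ hr z).1 ⟨x, y, h1, h2⟩
    exact pv_unique hw (hφ f hf).1 hg ha hb
  · intro f hf
    obtain ⟨h, hh, -⟩ := (hφ f hf).2
    rw [dom_comp (hsub f hf)] at hh
    exact ⟨h, hh⟩

theorem orbit_of_sameType {X : Type*} {S : Set (PartialBij X)}
    (hcomp : ∀ f ∈ S, ∀ g ∈ S, PartialBij.comp g f ∈ S)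
    (hinv : ∀ f ∈ S, PartialBij.inv f ∈ S) (SS : SStructure S)
    {v w : Set (PartialBij X)} (hv : IsPseudovertex S v) (hw : IsPseudovertex S w)
    (ht : SameType SS v w) :
    ∃ s : PartialBij X, LocallyDetermined S s ∧ s.domSet = PVImage v ∧ s.imgSet = PVImage w ∧
      PVEquiv SS (PVAct s v) w := by
  obtain ⟨φ, ⟨hm, hinj, hsurj⟩, hne⟩ := ht
  have : Finite v := hv.1
  choose h hh using fun f : v => hne f.1 f.2
  have hS := fun f : v => (SS.str_mem _ _ _ (hh f)).1
  have hdom := fun f : v => (SS.str_mem _ _ _ (hh f)).2.1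
  have himg := fun f : v => (SS.str_mem _ _ _ (hh f)).2.2
  let t : v → PartialBij X := fun f => ((φ f).comp (h f)).comp f.1.inv
  have hd : ∀ i j x y y', (t i).rel x y → (t j).rel x y' → i = j := by
    rintro i j x y y' ⟨a, h1, -⟩ ⟨a', h1', -⟩
    exact Subtype.ext (pv_unique hv i.2 j.2 h1 h1')
  have hi : ∀ i j x x' y, (t i).rel x y → (t j).rel x' y → i = j := by
    rintro i j x x' y ⟨a, -, b, -, h1⟩ ⟨a', -, b', -, h1'⟩
    exact Subtype.ext (hinj i.2 j.2 (pv_unique hw (hm i.2) (hm j.2) h1 h1'))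
  let s : PartialBij X :=
    { rel := fun x y => ∃ i, (t i).rel x y
      functional := by
        rintro x y y' ⟨i, h1⟩ ⟨j, h2⟩
        cases hd _ _ _ _ _ h1 h2
        exact (t i).functional h1 h2
      injective := by
        rintro x y y' ⟨i, h1⟩ ⟨j, h2⟩
        cases hi _ _ _ _ _ h1 h2
        exact (t i).injective h1 h2 }
  -- every point of the domain of `f` is moved along `h f`, then `φ f`
  have hfwd : ∀ (f : v) a, a ∈ f.1.domSet → ∃ b z, (h f).rel a b ∧ (φ f).rel b z := by
    intro f a ha
    have : a ∈ (h f).domSet := by rw [hdom]; exact ha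
    obtain ⟨b, hb⟩ := this
    have : b ∈ (φ f).domSet := by rw [← himg]; exact ⟨a, hb⟩
    obtain ⟨z, hz⟩ := this
    exact ⟨b, z, hb, hz⟩
  have hsd : s.domSet = PVImage v := by
    ext x
    simp only [PVImage, Set.mem_iUnion]
    constructor
    · rintro ⟨z, i, a, h1, -⟩
      exact ⟨i.1, i.2, a, h1⟩
    · rintro ⟨f, hf, a, h1⟩
      obtain ⟨b, z, hb, hz⟩ := hfwd ⟨f, hf⟩ a ⟨x, h1⟩
      exact ⟨z, ⟨f, hf⟩, a, h1, b, hb, hz⟩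
  have hsi : s.imgSet = PVImage w := by
    ext z
    simp only [PVImage, Set.mem_iUnion]
    constructor
    · rintro ⟨x, i, a, -, b, -, h1⟩
      exact ⟨φ i, hm i.2, b, h1⟩
    · rintro ⟨g, hg, b, h1⟩
      obtain ⟨f, hf, rfl⟩ := hsurj hg
      have : b ∈ (h ⟨f, hf⟩).imgSet := by rw [himg]; exact ⟨z, h1⟩
      obtain ⟨a, ha⟩ := this
      have : a ∈ f.domSet := by
        have h2 := hdom ⟨f, hf⟩
        dsimp only at h2
        rw [← h2]; exact ⟨b, ha⟩
      obtain ⟨x, hx⟩ := this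
      exact ⟨x, ⟨f, hf⟩, a, hx, b, ha, h1⟩
  have hrel : ∀ f : v, PairRel SS (s.comp f.1) (φ f) := by
    intro f
    have hsub : f.1.imgSet ⊆ s.domSet := by
      rw [hsd]; exact fun y hy => Set.mem_biUnion f.2 hy
    refine ⟨h f, ?_, ?_⟩
    · rw [dom_comp hsub]; exact hh f
    · apply PartialBij.ext_rel
      intro a z
      constructor
      · rintro ⟨x, h1, i, a', h2, b, h3, h4⟩
        have e : f = i := Subtype.ext (pv_unique hv f.2 i.2 h1 h2)
        subst e
        cases f.1.injective h1 h2
        exact ⟨b, h3, h4⟩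
      · rintro ⟨b, h3, h4⟩
        have : a ∈ f.1.domSet := by rw [← hdom]; exact ⟨b, h3⟩
        obtain ⟨x, hx⟩ := this
        exact ⟨x, hx, f, a, hx, b, h3, h4⟩
  refine ⟨s, ?_, hsd, hsi, ?_, ?_⟩
  · refine ld_union t ?_ hd hi (fun _ _ => Iff.rfl)
    intro f
    exact ld_comp hcomp (ld_inv hinv (hv.2.2.1 _ f.2).2.2)
      (ld_comp hcomp (ld_of_mem (hS f)) (hw.2.2.1 _ (hm f.2)).2.2)
  · rintro _ ⟨f, hf, rfl⟩
    exact ⟨φ f, hm hf, hrel ⟨f, hf⟩⟩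
  · intro g hg
    obtain ⟨f, hf, rfl⟩ := hsurj hg
    exact ⟨_, ⟨f, hf, rfl⟩, hrel ⟨f, hf⟩⟩

end GTLD

namespace GTLD

/-- two vertices (pseudovertices with image `X`) are in the same
`Γ_S`-orbit iff they have the same type; more generally, two pseudovertices are
in the same `Ŝ`-orbit iff they have the same type. -/
theorem statement15 {X : Type*} (S : Set (PartialBij X))
    (hcomp : ∀ f ∈ S, ∀ g ∈ S, PartialBij.comp g f ∈ S)
    (hinv : ∀ f ∈ S, PartialBij.inv f ∈ S)
    (SS : SStructure S)
    (hX : FinDisjUnionOfDomains S Set.univ) :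
    (∀ v₁ v₂ : Set (PartialBij X), IsPseudovertex S v₁ → IsPseudovertex S v₂ →
      PVImage v₁ = Set.univ → PVImage v₂ = Set.univ →
      ((∃ γ : PartialBij X, MemGamma S γ ∧ PVEquiv SS (PVAct γ v₁) v₂)
        ↔ SameType SS v₁ v₂)) ∧
    (∀ v w : Set (PartialBij X), IsPseudovertex S v → IsPseudovertex S w →
      ((∃ s : PartialBij X, LocallyDetermined S s ∧ PVImage v ⊆ s.domSet ∧
          PVEquiv SS (PVAct s v) w)
        ↔ SameType SS v w)) := by
  refine ⟨?_, ?_⟩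
  · intro v₁ v₂ h₁ h₂ e₁ e₂
    constructor
    · rintro ⟨γ, hγ, he⟩
      exact sameType_of_orbit SS h₁ h₂ (by rw [hγ.1]; exact Set.subset_univ _) he
    · intro ht
      obtain ⟨s, hs, hd, hi, he⟩ := orbit_of_sameType hcomp hinv SS h₁ h₂ ht
      exact ⟨s, ⟨hd.trans e₁, hi.trans e₂, hs⟩, he⟩
  · intro v w hv hw
    constructor
    · rintro ⟨s, -, hs, he⟩
      exact sameType_of_orbit SS hv hw hs he
    · intro ht
      obtain ⟨s, hs, hd, hi, he⟩ := orbit_of_sameType hcomp hinv SS hv hw ht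
      exact ⟨s, hs, hd.symm.subset, he⟩

end GTLD
end
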